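/- Let n ≥ 4 be an even integer, let G be an n-vertex graph with minimum degree δ(G) ≥ n/2 + 2, and let χ be an edge-coloring of G with 2 colors under which G contains no even-chromatic Hamilton cycle. Then there exists a partition V(G) = A ⊔ B (one part possibly empty) such that: for any two distinct vertices x, y in the same part, χ(xu) = χ(yu) for every common neighbor u of x and y; and for any two vertices x, y in different parts, χ(xu) ≠ χ(yu) for every common neighbor u of x and y. -/

import Mathlib

namespace AgreePart
open Finset

def Valid {V : Type*} (S : Finset V) (a b : V) (p : ℕ → V) : Prop :=
  (∀ k, k < S.card → p k ∈ S) ∧ (∀ j k, j < S.card → k < S.card → p j = p k → j = k) ∧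
  (∀ v ∈ S, ∃ k, k < S.card ∧ p k = v) ∧ p 0 = a ∧ p (S.card - 1) = b

open Classical in
noncomputable def bad {V : Type*} (G : SimpleGraph V) (S : Finset V) (p : ℕ → V) : Finset ℕ :=
  (range (S.card - 1)).filter (fun k => ¬ G.Adj (p k) (p (k+1)))

def rev {V : Type*} (l m : ℕ) (p : ℕ → V) (k : ℕ) : V :=
  p (if l < k ∧ k ≤ m then l + 1 + m - k else k)

lemma exists_valid {V : Type*} [DecidableEq V] (S : Finset V) (a b : V) (ha : a ∈ S) (hb : b ∈ S)
    (hab : a ≠ b) : ∃ p, Valid S a b p := by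
  set L : List V := a :: (((S.erase a).erase b).toList ++ [b]) with hL
  have hnd : L.Nodup := by
    simp [hL, List.nodup_append, hab, Finset.nodup_toList]
    tauto
  have hmem : ∀ v, v ∈ L ↔ v ∈ S := by
    intro v
    simp only [hL, List.mem_cons, List.mem_append, Finset.mem_toList, Finset.mem_erase]
    by_cases h1 : v = a
    · simp [h1, ha]
    · by_cases h2 : v = b
      · simp [h2, hb]
      · simp [h1, h2]
  have hlen : L.length = S.card := by
    rw [← List.toFinset_card_of_nodup hnd]
    congr 1
    ext v; simp [hmem]
  refine ⟨fun k => L.getD k a, ?_, ?_, ?_, ?_, ?_⟩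
  · intro k hk
    rw [← hlen] at hk
    simp only [List.getD_eq_getElem _ _ hk]
    exact (hmem _).1 (List.getElem_mem hk)
  · intro j k hj hk h
    rw [← hlen] at hj hk
    simp only [List.getD_eq_getElem _ _ hk, List.getD_eq_getElem _ _ hj] at h
    exact (hnd.getElem_inj_iff).1 h
  · intro v hv
    obtain ⟨k, hk, h⟩ := List.getElem_of_mem ((hmem v).2 hv)
    exact ⟨k, hlen ▸ hk, by simp only [List.getD_eq_getElem _ _ hk, h]⟩
  · simp [hL]
  · rw [← hlen]
    have : L.length - 1 < L.length := by simp [hL]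
    simp only [List.getD_eq_getElem _ _ this]
    rw [← List.getLast_eq_getElem (by simp [hL])]
    simp [hL]

lemma step1 {V : Type*} (G : SimpleGraph V) (S : Finset V) (a b : V) (p : ℕ → V)
    (hp : Valid S a b p) (l m : ℕ) (hlm : l < m) (hm : m < S.card - 1)
    (h1 : G.Adj (p l) (p m)) (h2 : G.Adj (p (l+1)) (p (m+1)))
    (hbad : l ∈ bad G S p ∨ m ∈ bad G S p) :
    Valid S a b (rev l m p) ∧ (bad G S (rev l m p)).card < (bad G S p).card := by
  obtain ⟨q1, q2, q3, q4, q5⟩ := hp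
  refine ⟨⟨?_, ?_, ?_, ?_, ?_⟩, ?_⟩
  · intro k hk
    apply q1
    split_ifs <;> omega
  · intro j k hj hk h
    have := q2 _ _ (by split_ifs <;> omega) (by split_ifs <;> omega) h
    split_ifs at this <;> omega
  · intro v hv
    obtain ⟨k, hk, h⟩ := q3 v hv
    refine ⟨if l < k ∧ k ≤ m then l + 1 + m - k else k, by split_ifs <;> omega, ?_⟩
    rw [← h]
    unfold rev
    congr 1
    split_ifs <;> omega
  · rw [← q4]; unfold rev; congr 1
  · rw [← q5]; unfold rev; congr 1; split_ifs <;> omega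
  · have key : ∀ k ∈ bad G S (rev l m p), k ≠ l ∧ k ≠ m ∧
        (if l < k ∧ k < m then l + m - k else k) ∈ bad G S p := by
      intro k hk
      simp only [bad, mem_filter, mem_range] at hk ⊢
      obtain ⟨hk, hk2⟩ := hk
      have hkl : k ≠ l := by
        rintro rfl
        apply hk2
        unfold rev
        rw [if_neg (by omega), if_pos (by omega)]
        convert h1 using 2
        omega
      have hkm : k ≠ m := by
        rintro rfl
        apply hk2
        unfold rev
        rw [if_pos (by omega), if_neg (by omega)]
        convert h2 using 2
        omega
      refine ⟨hkl, hkm, ?_⟩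
      by_cases hh : l < k ∧ k < m
      · rw [if_pos hh]
        refine ⟨by omega, fun h => hk2 ?_⟩
        unfold rev
        rw [if_pos (by omega), if_pos (by omega)]
        convert h.symm using 2 <;> omega
      · rw [if_neg hh]
        refine ⟨hk, fun h => hk2 ?_⟩
        unfold rev
        rw [if_neg (by omega), if_neg (by omega)]
        exact h
    have hcard : (bad G S (rev l m p)).card ≤ (((bad G S p).erase l).erase m).card := by
      apply card_le_card_of_injOn (fun k => if l < k ∧ k < m then l + m - k else k)
      · intro k hk
        obtain ⟨e1, e2, e3⟩ := key k hk
        simp only [coe_erase, Set.mem_sdiff, Set.mem_singleton_iff, mem_coe]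
        refine ⟨⟨e3, ?_⟩, ?_⟩ <;> split_ifs <;> omega
      · intro j hj k hk h
        have hj' := key j hj
        have hk' := key k hk
        simp only at h
        split_ifs at h <;> omega
    refine lt_of_le_of_lt hcard (card_lt_card ?_)
    rw [ssubset_iff_of_subset ((erase_subset _ _).trans (erase_subset _ _))]
    rcases hbad with h | h
    · exact ⟨l, h, by simp⟩
    · exact ⟨m, h, by simp⟩

lemma step2 {V : Type*} [DecidableEq V] (G : SimpleGraph V) [DecidableRel G.Adj] (S : Finset V)
    (hS : ∀ v ∈ S, S.card + 1 ≤ 2 * (S.filter (G.Adj v)).card)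
    (a b : V) (p : ℕ → V)
    (hp : Valid S a b p) (i : ℕ) (hi : i ∈ bad G S p) :
    ∃ q, Valid S a b q ∧ (bad G S q).card < (bad G S p).card := by
  have hi' := hi
  simp only [bad, mem_filter, mem_range] at hi'
  obtain ⟨hiN, hna⟩ := hi'
  obtain ⟨q1, q2, q3, q4, q5⟩ := id hp
  set A := (range (S.card - 1)).filter (fun j => G.Adj (p i) (p j)) with hA
  set B := (range (S.card - 1)).filter (fun j => G.Adj (p (i+1)) (p (j+1))) with hB
  have cA : (S.filter (G.Adj (p i))).card ≤ A.card + 1 := by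
    have : S.filter (G.Adj (p i)) ⊆ insert (p (S.card - 1)) (A.image p) := by
      intro v hv
      rw [mem_filter] at hv
      obtain ⟨k, hk, rfl⟩ := q3 v hv.1
      by_cases h : k = S.card - 1
      · rw [h]; exact mem_insert_self _ _
      · apply mem_insert_of_mem
        apply mem_image_of_mem
        simp only [hA, mem_filter, mem_range]
        exact ⟨by omega, hv.2⟩
    exact (card_le_card this).trans ((card_insert_le _ _).trans (by gcongr; exact card_image_le))
  have cB : (S.filter (G.Adj (p (i+1)))).card ≤ B.card + 1 := by
    have : S.filter (G.Adj (p (i+1))) ⊆ insert (p 0) (B.image (fun j => p (j+1))) := by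
      intro v hv
      rw [mem_filter] at hv
      obtain ⟨k, hk, rfl⟩ := q3 v hv.1
      rcases k with _ | k
      · exact mem_insert_self _ _
      · apply mem_insert_of_mem
        apply mem_image_of_mem (fun j => p (j+1))
        simp only [hB, mem_filter, mem_range]
        exact ⟨by omega, hv.2⟩
    exact (card_le_card this).trans ((card_insert_le _ _).trans (by gcongr; exact card_image_le))
  have d1 := hS _ (q1 i (by omega))
  have d2 := hS _ (q1 (i+1) (by omega))
  have hAi : i ∉ A := by simp [hA]
  have hBi : i ∉ B := by simp [hB]
  have hnd : ¬ Disjoint A B := by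
    intro hd
    have := card_union_of_disjoint hd
    have h2 : (A ∪ B) ⊆ (range (S.card - 1)).erase i := by
      intro k hk
      rw [mem_erase]
      rcases mem_union.1 hk with h | h
      · exact ⟨fun e => hAi (e ▸ h), (mem_filter.1 h).1⟩
      · exact ⟨fun e => hBi (e ▸ h), (mem_filter.1 h).1⟩
    have h3 := card_le_card h2
    rw [card_erase_of_mem (mem_range.2 hiN), card_range] at h3
    omega
  rw [not_disjoint_iff] at hnd
  obtain ⟨j, hjA, hjB⟩ := hnd
  have hne : j ≠ i := fun e => hAi (e ▸ hjA)
  simp only [hA, hB, mem_filter, mem_range] at hjA hjB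
  rcases lt_or_gt_of_ne hne with h | h
  · exact ⟨_, step1 G S a b p hp j i h hiN hjA.2.symm hjB.2.symm (Or.inr hi)⟩
  · exact ⟨_, step1 G S a b p hp i j h hjA.1 hjA.2 hjB.2 (Or.inl hi)⟩

lemma walk_of {V : Type*} (G : SimpleGraph V) (p : ℕ → V) (k : ℕ)
    (h : ∀ j < k, G.Adj (p j) (p (j+1))) :
    ∃ w : G.Walk (p 0) (p k), w.support = (List.range (k+1)).map p := by
  induction k with
  | zero => exact ⟨.nil, by simp⟩
  | succ k ih =>
    obtain ⟨w, hw⟩ := ih (fun j hj => h j (by omega))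
    refine ⟨w.concat (h k (by omega)), ?_⟩
    rw [SimpleGraph.Walk.support_concat, hw, List.range_succ (n := k+1)]
    simp

lemma ham_conn {V : Type*} [DecidableEq V] (G : SimpleGraph V) [DecidableRel G.Adj] (S : Finset V)
    (hS : ∀ v ∈ S, S.card + 1 ≤ 2 * (S.filter (G.Adj v)).card)
    (a b : V) (ha : a ∈ S) (hb : b ∈ S) (hab : a ≠ b) :
    ∃ P : G.Walk a b, P.IsPath ∧ ∀ v, v ∈ P.support ↔ v ∈ S := by
  have main : ∀ k p, Valid S a b p → (bad G S p).card = k →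
      ∃ q, Valid S a b q ∧ bad G S q = ∅ := by
    intro k
    induction k using Nat.strong_induction_on with
    | _ k ih =>
      intro p hp hk
      by_cases h : bad G S p = ∅
      · exact ⟨p, hp, h⟩
      · obtain ⟨i, hi⟩ := nonempty_iff_ne_empty.2 h
        obtain ⟨q, hq, hlt⟩ := step2 G S hS a b p hp i hi
        exact ih _ (hk ▸ hlt) q hq rfl
  obtain ⟨p, hp⟩ := exists_valid S a b ha hb hab
  obtain ⟨q, ⟨q1, q2, q3, q4, q5⟩, hq⟩ := main _ p hp rfl
  have hpos : 0 < S.card := card_pos.2 ⟨a, ha⟩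
  obtain ⟨w, hw⟩ := walk_of G q (S.card - 1) (by
    intro j hj
    by_contra hc
    have : j ∈ bad G S q := by simp [bad, hj, hc]
    simp [hq] at this)
  rw [Nat.sub_add_cancel hpos] at hw
  subst q4
  subst q5
  refine ⟨w, ?_, ?_⟩
  · rw [SimpleGraph.Walk.isPath_def, hw]
    apply List.Nodup.map_on _ List.nodup_range
    intro x hx y hy hxy
    exact q2 x y (List.mem_range.1 hx) (List.mem_range.1 hy) hxy
  · intro v
    rw [hw, List.mem_map]
    constructor
    · rintro ⟨k, hk, rfl⟩
      exact q1 k (List.mem_range.1 hk)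
    · intro hv
      obtain ⟨k, hk, h⟩ := q3 v hv
      exact ⟨k, List.mem_range.2 hk, h⟩

open SimpleGraph

def col {V : Type*} (χ : Sym2 V → Fin 2) (x y : V) : ZMod 2 := ((χ s(x, y) : ℕ) : ZMod 2)

lemma col_comm {V : Type*} (χ : Sym2 V → Fin 2) (x y : V) : col χ x y = col χ y x := by
  unfold col; rw [Sym2.eq_swap]

lemma col_inj {V : Type*} (χ : Sym2 V → Fin 2) (x y u v : V) :
    col χ x y = col χ u v ↔ χ s(x, y) = χ s(u, v) := by
  unfold col
  generalize χ s(x, y) = a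
  generalize χ s(u, v) = b
  revert a b; decide

def wt {V : Type*} (χ : Sym2 V → Fin 2) (l : List (Sym2 V)) : ZMod 2 :=
  (l.map (fun e => ((χ e : ℕ) : ZMod 2))).sum

lemma wt_count {V : Type*} (χ : Sym2 V → Fin 2) (l : List (Sym2 V)) :
    wt χ l = ((l.filter (fun e => χ e = 1)).length : ZMod 2) ∧
    wt χ l + (l.length : ZMod 2) = ((l.filter (fun e => χ e = 0)).length : ZMod 2) := by
  induction l with
  | nil => simp [wt]
  | cons e l ih =>
    simp only [wt, List.map_cons, List.sum_cons, List.length_cons] at ih ⊢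
    have h2 : (2 : ZMod 2) = 0 := rfl
    have : χ e = 0 ∨ χ e = 1 := by
      generalize χ e = a
      revert a; decide
    rcases this with h | h
    · simp [h, ih.1.symm, ih.2.symm]
      ring
    · simp [h, ih.1.symm, ih.2.symm]
      constructor
      · ring
      · linear_combination h2

def NoEven {n : ℕ} (G : SimpleGraph (Fin n)) (χ : Sym2 (Fin n) → Fin 2) : Prop :=
  ¬ ∃ (a : Fin n) (w : G.Walk a a), w.IsHamiltonianCycle ∧
      ∀ c : Fin 2, Even ((w.edges.filter (fun e => χ e = c)).length)

lemma odd_ham {n : ℕ} (hn : 4 ≤ n) (hne : Even n) (G : SimpleGraph (Fin n))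
    (χ : Sym2 (Fin n) → Fin 2) (hno : NoEven G χ) {a b : Fin n} (h : G.Adj b a)
    (p : G.Walk a b) (hp : p.IsPath) (hall : ∀ v, v ∈ p.support) :
    wt χ p.edges + col χ b a = 1 := by
  have hH : p.IsHamiltonian := hp.isHamiltonian_of_mem hall
  have hlen : p.length = n - 1 := by simpa using hH.length_eq
  by_contra hc
  apply hno
  have hcyc : (Walk.cons h p).IsHamiltonianCycle := by
    rw [Walk.isHamiltonianCycle_iff_isCycle_and_length_eq, Walk.cons_isCycle_iff]
    refine ⟨⟨hp, fun hmem => ?_⟩, by simp [hlen]; omega⟩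
    rw [Sym2.eq_swap] at hmem
    have := hp.length_eq_one_of_mem_edges hmem
    omega
  refine ⟨b, Walk.cons h p, hcyc, ?_⟩
  have h0 : wt χ (Walk.cons h p).edges = 0 := by
    have e : wt χ (Walk.cons h p).edges = wt χ p.edges + col χ b a := by
      simp [wt, col, add_comm]
    rw [e]
    generalize wt χ p.edges + col χ b a = z at hc
    revert z; decide
  obtain ⟨c1, c2⟩ := wt_count χ (Walk.cons h p).edges
  have hl : ((Walk.cons h p).edges.length : ZMod 2) = 0 := by
    rw [Walk.length_edges, hcyc.length_eq, Fintype.card_fin]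
    exact (ZMod.natCast_eq_zero_iff_even).2 hne
  rw [h0, hl, add_zero] at c2
  rw [h0] at c1
  intro c
  have : c = 0 ∨ c = 1 := by revert c; decide
  rcases this with rfl | rfl
  · exact (ZMod.natCast_eq_zero_iff_even).1 c2.symm
  · exact (ZMod.natCast_eq_zero_iff_even).1 c1.symm

lemma four_aux {n : ℕ} (hn : 4 ≤ n) (hne : Even n) (G : SimpleGraph (Fin n))
    (χ : Sym2 (Fin n) → Fin 2) (hno : NoEven G χ) {x y u v w : Fin n}
    (hxu : G.Adj x u) (hyv : G.Adj y v) (hxw : G.Adj x w) (hyw : G.Adj y w) (hxy : x ≠ y)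
    (P : G.Walk u v) (hP : P.IsPath) (hs : ∀ t, t ∈ P.support ↔ t ∉ ({x, y, w} : Finset (Fin n))) :
    wt χ P.edges + col χ y v + col χ y w + col χ x w + col χ x u = 1 := by
  have := odd_ham hn hne G χ hno hxu
    (P.append (.cons hyv.symm (.cons hyw (.cons hxw.symm .nil)))) (by
      rw [Walk.isPath_def, Walk.support_append]
      have := hP.support_nodup
      have a1 := hxw.ne
      have a2 := hyw.ne
      simp [List.nodup_append, this, hs]
      grind) (by
      intro t
      by_cases h : t ∈ ({x, y, w} : Finset (Fin n))
      · simp at h ⊢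
        grind
      · rw [← hs] at h
        simp [h])
  rw [← this]
  simp [wt, col, Sym2.eq_swap]
  ring

lemma six_aux {n : ℕ} (hn : 4 ≤ n) (hne : Even n) (G : SimpleGraph (Fin n))
    (χ : Sym2 (Fin n) → Fin 2) (hno : NoEven G χ) {x y z u v w s t : Fin n}
    (hxu : G.Adj x u) (hus : G.Adj u s) (hws : G.Adj w s) (hzw : G.Adj z w) (hzt : G.Adj z t)
    (hyt : G.Adj y t) (hyv : G.Adj y v)
    (hnd : [u, s, w, z, t, y].Nodup)
    (P : G.Walk v x) (hP : P.IsPath)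
    (hs : ∀ q, q ∈ P.support ↔ q ∉ [u, s, w, z, t, y]) :
    wt χ P.edges + col χ x u + col χ u s + col χ w s + col χ z w + col χ z t + col χ y t
      + col χ y v = 1 := by
  have := odd_ham hn hne G χ hno hyv
    (P.append (.cons hxu (.cons hus (.cons hws.symm (.cons hzw.symm
      (.cons hzt (.cons hyt.symm .nil))))))) (by
      rw [Walk.isPath_def, Walk.support_append]
      have h1 := hP.support_nodup
      simp only [Walk.support_cons, Walk.support_nil, List.tail_cons]
      rw [List.nodup_append]
      refine ⟨h1, hnd, ?_⟩
      intro a ha b hb hab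
      exact (hs a).1 ha (hab ▸ hb)) (by
      intro q
      by_cases h : q ∈ [u, s, w, z, t, y]
      · simp at h ⊢
        grind
      · rw [← hs] at h
        simp [h])
  rw [← this, col_comm χ w s, col_comm χ z w, col_comm χ y t]
  simp [wt, col]
  ring

lemma pick {n : ℕ} (hne : Even n) (G : SimpleGraph (Fin n)) [DecidableRel G.Adj]
    (hδ : n / 2 + 2 ≤ G.minDegree) (x y : Fin n) (F : Finset (Fin n)) (hF : F.card ≤ 3) :
    ∃ u, u ∉ F ∧ G.Adj x u ∧ G.Adj y u := by
  have h1 := hδ.trans (G.minDegree_le_degree x)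
  have h2 := hδ.trans (G.minDegree_le_degree y)
  rw [← G.card_neighborFinset_eq_degree] at h1 h2
  have h3 := card_union_add_card_inter (G.neighborFinset x) (G.neighborFinset y)
  have h4 : (G.neighborFinset x ∪ G.neighborFinset y).card ≤ n := by
    simpa using card_le_univ (G.neighborFinset x ∪ G.neighborFinset y)
  obtain ⟨k, hk⟩ := hne
  obtain ⟨u, hu, hu2⟩ := exists_mem_notMem_of_card_lt_card
    (s := F) (t := G.neighborFinset x ∩ G.neighborFinset y) (by omega)
  simp at hu
  exact ⟨u, hu2, hu⟩

lemma conn_off {n : ℕ} (hne : Even n) (G : SimpleGraph (Fin n)) [DecidableRel G.Adj]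
    (hδ : n / 2 + 2 ≤ G.minDegree) (R : Finset (Fin n)) (d : ℕ)
    (hR : ∀ v, v ∉ R → (R.filter (G.Adj v)).card ≤ d) (hd : 2 * d ≤ R.card + 3)
    (a b : Fin n) (ha : a ∉ R) (hb : b ∉ R) (hab : a ≠ b) :
    ∃ P : G.Walk a b, P.IsPath ∧ ∀ v, v ∈ P.support ↔ v ∉ R := by
  have := ham_conn G Rᶜ (by
    intro v hv
    have h1 := hδ.trans (G.minDegree_le_degree v)
    have h2 := hR v (by simpa using hv)
    have h3 : G.degree v ≤ (Rᶜ.filter (G.Adj v)).card + (R.filter (G.Adj v)).card := by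
      rw [← G.card_neighborFinset_eq_degree]
      refine le_trans (card_le_card ?_) (card_union_le _ _)
      intro t ht
      simp at ht ⊢
      tauto
    have h4 := card_compl_add_card R
    simp only [Fintype.card_fin] at h4
    obtain ⟨k, hk⟩ := hne
    omega) a b (by simpa) (by simpa) hab
  simpa using this

lemma four {n : ℕ} (hn : 4 ≤ n) (hne : Even n) (G : SimpleGraph (Fin n)) [DecidableRel G.Adj]
    (hδ : n / 2 + 2 ≤ G.minDegree)
    (χ : Sym2 (Fin n) → Fin 2) (hno : NoEven G χ) (x y u v : Fin n)
    (hxu : G.Adj x u) (hyu : G.Adj y u) (hxv : G.Adj x v) (hyv : G.Adj y v) :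
    col χ x u + col χ y u = col χ x v + col χ y v := by
  have h2 : ∀ a : ZMod 2, a + a = 0 := by decide
  by_cases hxy : x = y
  · subst hxy; rw [h2, h2]
  by_cases huv : u = v
  · subst huv; rfl
  obtain ⟨w, hw, hxw, hyw⟩ := pick hne G hδ x y {u, v} (card_le_two.trans (by norm_num))
  have e1 := hxu.ne
  have e2 := hyu.ne
  have e3 := hxv.ne
  have e4 := hyv.ne
  have e5 := hxw.ne
  have e6 := hyw.ne
  simp at hw
  have hRc : ({x, y, w} : Finset (Fin n)).card = 3 := by
    rw [card_eq_three]; exact ⟨x, y, w, hxy, e5, e6, rfl⟩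
  obtain ⟨P, hP, hs⟩ := conn_off hne G hδ {x, y, w} 3
    (fun v _ => (card_filter_le _ _).trans hRc.le) (by omega) u v
    (by simp; grind) (by simp; grind) huv
  have r1 := four_aux hn hne G χ hno hxu hyv hxw hyw hxy P hP hs
  have r2 := four_aux hn hne G χ hno hxv hyu hxw hyw hxy P.reverse hP.reverse
    (by intro t; simpa using hs t)
  have r3 : wt χ P.reverse.edges = wt χ P.edges := by
    simp [wt, List.map_reverse]
  rw [r3] at r2
  have c : (2 : ZMod 2) = 0 := rfl
  linear_combination r1 - r2 + (col χ y u - col χ y v) * c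

lemma filter_three {n : ℕ} (p : Fin n → Prop) [DecidablePred p] (a b c : Fin n)
    (h : ¬ (p a ∧ p b ∧ p c)) : (({a, b, c} : Finset (Fin n)).filter p).card ≤ 2 := by
  have h1 : ({a, b, c} : Finset (Fin n)).filter p ⊂ {a, b, c} := by
    rw [filter_ssubset]
    by_contra hc
    simp at hc
    exact h hc
  have := card_lt_card h1
  have := card_le_three (a := a) (b := b) (c := c)
  omega

lemma six {n : ℕ} (hn : 4 ≤ n) (hne : Even n) (G : SimpleGraph (Fin n)) [DecidableRel G.Adj]
    (hδ : n / 2 + 2 ≤ G.minDegree)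
    (χ : Sym2 (Fin n) → Fin 2) (hno : NoEven G χ) (x y z u v w : Fin n)
    (hxy : x ≠ y) (hyz : y ≠ z) (hxz : x ≠ z)
    (hzu : z ≠ u) (hxv : x ≠ v) (hyw : y ≠ w)
    (hxu : G.Adj x u) (hyu : G.Adj y u) (hyv : G.Adj y v) (hzv : G.Adj z v)
    (hxw : G.Adj x w) (hzw : G.Adj z w) :
    col χ x u + col χ y u + col χ y v + col χ z v + col χ x w + col χ z w = 0 := by
  have c : (2 : ZMod 2) = 0 := rfl
  have F := four hn hne G hδ χ hno
  by_contra hodd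
  have n1 : ∀ q, ¬ (G.Adj x q ∧ G.Adj y q ∧ G.Adj z q) := by
    rintro q ⟨h1, h2, h3⟩
    apply hodd
    linear_combination F x y u q hxu hyu h1 h2 + F y z v q hyv hzv h2 h3 +
      F x z w q hxw hzw h1 h3 + (col χ x q + col χ y q + col χ z q) * c
  have n2 : ∀ v, G.Adj y v → G.Adj z v → ∀ q, ¬ (G.Adj q u ∧ G.Adj q v ∧ G.Adj q w) := by
    rintro v' hyv' hzv' q ⟨h1, h2, h3⟩
    apply hodd
    have g1 := F u w x q hxu.symm hxw.symm h1.symm h3.symm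
    have g2 := F u v' y q hyu.symm hyv'.symm h1.symm h2.symm
    have g3 := F v' w z q hzv'.symm hzw.symm h2.symm h3.symm
    have g4 := F y z v v' hyv hzv hyv' hzv'
    simp only [col_comm χ u, col_comm χ w, col_comm χ v'] at g1 g2 g3
    linear_combination g1 + g2 + g3 + g4 + (col χ q u + col χ q v' + col χ q w) * c
  obtain ⟨t, ht, hyt, hzt⟩ := pick hne G hδ y z {x, v} (card_le_two.trans (by norm_num))
  obtain ⟨s, hs, hus, hws⟩ := pick hne G hδ u w {x, t, v} card_le_three
  have n3 : ∀ q, ¬ (G.Adj q y ∧ G.Adj q z ∧ G.Adj q s) := by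
    rintro q ⟨h1, h2, h3⟩
    apply hodd
    have g0 := F u w x s hxu.symm hxw.symm hus hws
    have g1 := F y s u q hyu hus.symm h1.symm h3.symm
    have g2 := F s z w q hws.symm hzw h3.symm h2.symm
    have g3 := F y z v q hyv hzv h1.symm h2.symm
    rw [col_comm χ u x, col_comm χ w x, col_comm χ u s, col_comm χ w s] at g0
    linear_combination g0 + g1 + g2 + g3 + (col χ y q + col χ s q + col χ z q) * c
  simp only [mem_insert, mem_singleton, not_or] at ht hs
  have zu : ¬ G.Adj z u := fun h => n1 u ⟨hxu, hyu, h⟩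
  have yw : ¬ G.Adj y w := fun h => n1 w ⟨hxw, h, hzw⟩
  have xv : ¬ G.Adj x v := fun h => n1 v ⟨h, hyv, hzv⟩
  have d1 : u ≠ s := hus.ne
  have d2 : u ≠ w := by rintro rfl; exact zu hzw
  have d3 : u ≠ t := by rintro rfl; exact zu hzt
  have d4 : s ≠ w := hws.ne.symm
  have d5 : s ≠ z := by rintro rfl; exact zu hus.symm
  have d6 : s ≠ y := by rintro rfl; exact yw hws.symm
  have d7 : w ≠ t := by rintro rfl; exact yw hyt
  have d8 : v ≠ u := by rintro rfl; exact zu hzv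
  have d9 : v ≠ w := by rintro rfl; exact yw hyv
  have b1 := hyu.ne
  have b2 := hzw.ne
  have b3 := hyt.ne
  have b4 := hzt.ne
  have b5 := hyv.ne
  have b6 := hzv.ne
  have b7 := hxu.ne
  have b8 := hxw.ne
  have hnd : [u, s, w, z, t, y].Nodup := by
    simp
    clear c
    grind
  have hnd' : [w, s, u, y, t, z].Nodup := by
    simp
    clear c
    grind
  have hRe : ([u, s, w, z, t, y] : List (Fin n)).toFinset = {u, t, w} ∪ {y, z, s} := by
    ext q; simp; tauto
  have hRc : ({u, t, w} ∪ {y, z, s} : Finset (Fin n)).card = 6 := by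
    rw [← hRe, List.toFinset_card_of_nodup hnd]; rfl
  obtain ⟨P, hP, hPs⟩ := conn_off hne G hδ ({u, t, w} ∪ {y, z, s}) 4 (by
    intro q _
    rw [filter_union]
    have k1 := filter_three (G.Adj q) u t w (n2 t hyt hzt q)
    have k2 := filter_three (G.Adj q) y z s (n3 q)
    exact (card_union_le _ _).trans (by omega)) (by omega) v x
    (by clear c; simp; grind) (by clear c; simp; grind) (Ne.symm hxv)
  have r1 := six_aux hn hne G χ hno hxu hus hws hzw hzt hyt hyv hnd P hP (by
    intro q; rw [hPs, ← hRe, List.mem_toFinset])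
  have r2 := six_aux hn hne G χ hno hxw hws hus hyu hyt hzt hzv hnd' P hP (by
    intro q; rw [hPs, ← hRe, List.mem_toFinset]; simp; tauto)
  apply hodd
  linear_combination r1 - r2 + (col χ y u + col χ z v + col χ x w) * c

end AgreePart


/-- Let `n ≥ 4` be even, `G` an `n`-vertex graph with `δ(G) ≥ n/2 + 2`, and
`χ` a 2-coloring of its edges admitting no even-chromatic Hamilton cycle. Then
there is a partition `V(G) = A ⊔ B` (a part possibly empty) such that vertices
in the same part agree and vertices in different parts disagree on every
common neighbor. -/
theorem agreement_partition_of_no_even_hamilton (n : ℕ) (hn : 4 ≤ n) (hne : Even n)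
    (G : SimpleGraph (Fin n)) [DecidableRel G.Adj]
    (hδ : n / 2 + 2 ≤ G.minDegree)
    (χ : Sym2 (Fin n) → Fin 2)
    (hno : ¬ ∃ (a : Fin n) (w : G.Walk a a), w.IsHamiltonianCycle ∧
      ∀ c : Fin 2, Even ((w.edges.filter (fun e => χ e = c)).length)) :
    ∃ A B : Set (Fin n),
      (∀ v, (v ∈ A ∧ v ∉ B) ∨ (v ∈ B ∧ v ∉ A)) ∧
      (∀ x y : Fin n, x ≠ y → ((x ∈ A ∧ y ∈ A) ∨ (x ∈ B ∧ y ∈ B)) →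
        ∀ u, G.Adj x u → G.Adj y u → χ s(x, u) = χ s(y, u)) ∧
      (∀ x y : Fin n, ((x ∈ A ∧ y ∈ B) ∨ (x ∈ B ∧ y ∈ A)) →
        ∀ u, G.Adj x u → G.Adj y u → χ s(x, u) ≠ χ s(y, u)) := by
  classical
  have F := AgreePart.four hn hne G hδ χ hno
  have S := AgreePart.six hn hne G hδ χ hno
  have c : (2 : ZMod 2) = 0 := rfl
  have hex : ∀ x y : Fin n, ∃ d : ZMod 2, ∀ u, G.Adj x u → G.Adj y u →
      AgreePart.col χ x u + AgreePart.col χ y u = d := by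
    intro x y
    obtain ⟨u, -, h1, h2⟩ := AgreePart.pick hne G hδ x y ∅ (by simp)
    exact ⟨_, fun v h3 h4 => F x y v u h3 h4 h1 h2⟩
  choose d hd using hex
  have dself : ∀ x, d x x = 0 := by
    intro x
    obtain ⟨u, -, h1, h2⟩ := AgreePart.pick hne G hδ x x ∅ (by simp)
    rw [← hd x x u h1 h2]
    linear_combination AgreePart.col χ x u * c
  have dcomm : ∀ x y, d x y = d y x := by
    intro x y
    obtain ⟨u, -, h1, h2⟩ := AgreePart.pick hne G hδ x y ∅ (by simp)
    rw [← hd x y u h1 h2, ← hd y x u h2 h1, add_comm]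
  have tri : ∀ x y z, d x y + d y z + d x z = 0 := by
    intro x y z
    by_cases hxy : x = y
    · subst hxy; rw [dself]; linear_combination d x z * c
    by_cases hyz : y = z
    · subst hyz; rw [dself]; linear_combination d x y * c
    by_cases hxz : x = z
    · subst hxz; rw [dself, dcomm y x]; linear_combination d x y * c
    obtain ⟨u, hu, hxu, hyu⟩ := AgreePart.pick hne G hδ x y {z} (by simp)
    obtain ⟨v, hv, hyv, hzv⟩ := AgreePart.pick hne G hδ y z {x} (by simp)
    obtain ⟨w, hw, hxw, hzw⟩ := AgreePart.pick hne G hδ x z {y} (by simp)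
    have := S x y z u v w hxy hyz hxz (fun h => hu (by simp [h])) (fun h => hv (by simp [h]))
      (fun h => hw (by simp [h])) hxu hyu hyv hzv hxw hzw
    rw [← hd x y u hxu hyu, ← hd y z v hyv hzv, ← hd x z w hxw hzw]
    linear_combination this
  have two : ∀ a : ZMod 2, a = 0 ∨ a = 1 := by decide
  let o : Fin n := ⟨0, by omega⟩
  refine ⟨{v | d o v = 0}, {v | ¬ d o v = 0}, ?_, ?_, ?_⟩
  · intro v
    by_cases h : d o v = 0 <;> simp [h]
  · intro x y _ h u hx hy
    rw [← AgreePart.col_inj]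
    have h1 := tri o x y
    have h2 := hd x y u hx hy
    simp only [Set.mem_ofPred_eq] at h
    rcases two (d o x) with e1 | e1 <;> rcases two (d o y) with e2 | e2 <;>
      simp only [e1, e2] at h h1
    · linear_combination h2 + h1 - AgreePart.col χ y u * c
    · simp at h
    · simp at h
    · linear_combination h2 + h1 - (AgreePart.col χ y u + 1) * c
  · intro x y h u hx hy
    rw [Ne, ← AgreePart.col_inj]
    intro h3
    have h1 := tri o x y
    have h2 := hd x y u hx hy
    have h4 : d x y = 0 := by
      linear_combination -h2 + h3 + AgreePart.col χ y u * c
    simp only [Set.mem_ofPred_eq] at h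
    rcases two (d o x) with e1 | e1 <;> rcases two (d o y) with e2 | e2 <;>
      simp [e1, e2, h4] at h h1
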